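/- If a semigroup X is absolutely T₁S-closed, then the set Z(X) ∩ √VE(X) is finite, where √VE(X) = {x ∈ X : xⁿ ∈ VE(X) for some n ≥ 1}. -/

import Mathlib

universe u

open Set TopologicalSpace

/-- A topological space is zero-dimensional: it has a base of clopen sets. -/
def HasClopenBasis (Y : Type*) [TopologicalSpace Y] : Prop :=
  ∃ B : Set (Set Y), (∀ s ∈ B, IsClopen s) ∧ IsTopologicalBasis B

section TopClasses

variable (X : Type u) [Semigroup X]

/-- `X` is absolutely `T₁S`-closed: the image of every homomorphism to a `T₁`
topological semigroup is closed. -/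
def AbsolutelyT1SClosed : Prop :=
  ∀ (Y : Type u) [Semigroup Y] [TopologicalSpace Y] [ContinuousMul Y] [T1Space Y]
    (h : X →ₙ* Y), IsClosed (Set.range h)

/-- `X` is absolutely `T₂S`-closed. -/
def AbsolutelyT2SClosed : Prop :=
  ∀ (Y : Type u) [Semigroup Y] [TopologicalSpace Y] [ContinuousMul Y] [T2Space Y]
    (h : X →ₙ* Y), IsClosed (Set.range h)

/-- `X` is absolutely `TzS`-closed. -/
def AbsolutelyTzSClosed : Prop :=
  ∀ (Y : Type u) [Semigroup Y] [TopologicalSpace Y] [ContinuousMul Y] [T1Space Y],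
    HasClopenBasis Y → ∀ (h : X →ₙ* Y), IsClosed (Set.range h)

/-- `X` is `T₁S`-closed: the image of every injective homomorphism to a `T₁`
topological semigroup with discrete image is closed. -/
def T1SClosed : Prop :=
  ∀ (Y : Type u) [Semigroup Y] [TopologicalSpace Y] [ContinuousMul Y] [T1Space Y]
    (h : X →ₙ* Y), Function.Injective h → DiscreteTopology (Set.range h) →
      IsClosed (Set.range h)

/-- `X` is `T₂S`-closed. -/
def T2SClosed : Prop :=
  ∀ (Y : Type u) [Semigroup Y] [TopologicalSpace Y] [ContinuousMul Y] [T2Space Y]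
    (h : X →ₙ* Y), Function.Injective h → DiscreteTopology (Set.range h) →
      IsClosed (Set.range h)

/-- `X` is `TzS`-closed. -/
def TzSClosed : Prop :=
  ∀ (Y : Type u) [Semigroup Y] [TopologicalSpace Y] [ContinuousMul Y] [T1Space Y],
    HasClopenBasis Y → ∀ (h : X →ₙ* Y), Function.Injective h →
      DiscreteTopology (Set.range h) → IsClosed (Set.range h)

/-- `X` is injectively `T₂S`-closed. -/
def InjectivelyT2SClosed : Prop :=
  ∀ (Y : Type u) [Semigroup Y] [TopologicalSpace Y] [ContinuousMul Y] [T2Space Y]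
    (h : X →ₙ* Y), Function.Injective h → IsClosed (Set.range h)

/-- `X` is projectively `T₁S`-closed: all congruence quotients are `T₁S`-closed. -/
def ProjectivelyT1SClosed : Prop := ∀ c : Con X, T1SClosed c.Quotient

/-- `X` is projectively `TzS`-closed. -/
def ProjectivelyTzSClosed : Prop := ∀ c : Con X, TzSClosed c.Quotient

/-- `X` is projectively `T₁S`-discrete: every homomorphism into a `T₁`
topological semigroup has discrete image. -/
def ProjectivelyT1SDiscrete : Prop :=
  ∀ (Y : Type u) [Semigroup Y] [TopologicalSpace Y] [ContinuousMul Y] [T1Space Y]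
    (h : X →ₙ* Y), DiscreteTopology (Set.range h)

/-- `X` is projectively `TzS`-discrete. -/
def ProjectivelyTzSDiscrete : Prop :=
  ∀ (Y : Type u) [Semigroup Y] [TopologicalSpace Y] [ContinuousMul Y] [T1Space Y],
    HasClopenBasis Y → ∀ (h : X →ₙ* Y), DiscreteTopology (Set.range h)

end TopClasses

/-- `spow x n` is the power `x^(n+1)` in a semigroup; thus as `n` ranges over `ℕ`,
`spow x n` ranges over all powers `x^m`, `m ≥ 1`. -/
def spow {X : Type*} [Semigroup X] (x : X) : ℕ → X
  | 0 => x
  | n + 1 => spow x n * x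

section AlgDefs

variable (X : Type*) [Semigroup X]

/-- the set `E(X)` of idempotents. -/
def idemSet : Set X := {x | x * x = x}

/-- `H_e`, the maximal subgroup containing the idempotent `e`. -/
def maxSubgroup (e : X) : Set X :=
  {x | x * e = x ∧ e * x = x ∧ ∃ y, y * e = y ∧ e * y = y ∧ x * y = e ∧ y * x = e}

/-- The Clifford part `H(X) = ⋃_{e ∈ E(X)} H_e`. -/
def cliffordPart : Set X := ⋃ e ∈ idemSet X, maxSubgroup X e

/-- `H_e/e := {x : xe = ex ∈ H_e}`. -/
def HeCoideal (e : X) : Set X := {x | x * e = e * x ∧ x * e ∈ maxSubgroup X e}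

/-- `I` is an ideal of the semigroup `X`. -/
def IsIdealSet (I : Set X) : Prop := ∀ x ∈ I, ∀ y : X, x * y ∈ I ∧ y * x ∈ I

/-- The set `VE(X)` of viable idempotents: `e` is idempotent and `X ∖ (H_e/e)` is an ideal. -/
def viableIdems : Set X := {e | e ∈ idemSet X ∧ IsIdealSet X (Set.univ \ HeCoideal X e)}

/-- The center `Z(X)`. -/
def centerSet : Set X := {z | ∀ x, z * x = x * z}

/-- `√A = {x : xⁿ ∈ A for some n ≥ 1}`. -/
def sqrtSet (A : Set X) : Set X := {x | ∃ n : ℕ, spow x n ∈ A}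

/-- A subset `B ⊆ X` is bounded: there is `n ≥ 1` with `xⁿ` idempotent for all `x ∈ B`. -/
def BoundedSet (B : Set X) : Prop := ∃ n : ℕ, ∀ x ∈ B, spow x n ∈ idemSet X

/-- The semigroup `X` is bounded. -/
def BoundedSemigroup : Prop := ∃ n : ℕ, ∀ x : X, spow x n ∈ idemSet X

/-- `X` is chain-finite. -/
def ChainFinite : Prop :=
  ∀ I : Set X, I.Infinite → ∃ x ∈ I, ∃ y ∈ I, x * y ≠ x ∧ x * y ≠ y

/-- `G ⊆ X` is a subgroup of the semigroup `X`. -/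
def IsSubgroupSet (G : Set X) : Prop :=
  (∀ x ∈ G, ∀ y ∈ G, x * y ∈ G) ∧
    ∃ e ∈ G, (∀ x ∈ G, x * e = x ∧ e * x = x) ∧ ∀ x ∈ G, ∃ y ∈ G, x * y = e ∧ y * x = e

/-- `X` is group-finite: all its subgroups are finite. -/
def GroupFinite : Prop := ∀ G : Set X, IsSubgroupSet X G → G.Finite

/-- `X` is Clifford+finite: `X ∖ H(X)` is finite. -/
def CliffordPlusFinite : Prop := (Set.univ \ cliffordPart X).Finite

/-- `X` is `E`-commutative: idempotents commute. -/
def ECommutative : Prop := ∀ x ∈ idemSet X, ∀ y ∈ idemSet X, x * y = y * x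

end AlgDefs

/-- The Rees congruence associated with an ideal `I` of `X`. -/
def ReesCon {X : Type*} [Semigroup X] (I : Set X) (hI : IsIdealSet X I) : Con X where
  r x y := x = y ∨ (x ∈ I ∧ y ∈ I)
  iseqv :=
    { refl := fun _ => Or.inl rfl
      symm := by rintro x y (rfl | ⟨h1, h2⟩); exacts [Or.inl rfl, Or.inr ⟨h2, h1⟩]
      trans := by
        rintro x y z (rfl | ⟨h1, h2⟩) (rfl | ⟨h3, h4⟩)
        exacts [Or.inl rfl, Or.inr ⟨h3, h4⟩, Or.inr ⟨h1, h2⟩, Or.inr ⟨h1, h4⟩] }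
  mul' := by
    rintro a b c d (rfl | ⟨h1, h2⟩) (rfl | ⟨h3, h4⟩)
    · exact Or.inl rfl
    · exact Or.inr ⟨(hI c h3 a).2, (hI d h4 a).2⟩
    · exact Or.inr ⟨(hI a h1 c).1, (hI b h2 c).1⟩
    · exact Or.inr ⟨(hI a h1 c).1, (hI b h2 d).1⟩

/-- `X` is ideally `T₂S`-closed: all its Rees quotients are `T₂S`-closed. -/
def IdeallyT2SClosed (X : Type u) [Semigroup X] : Prop :=
  ∀ (I : Set X) (hI : IsIdealSet X I), T2SClosed (ReesCon I hI).Quotient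

/-- `X` is ideally `TzS`-closed. -/
def IdeallyTzSClosed (X : Type u) [Semigroup X] : Prop :=
  ∀ (I : Set X) (hI : IsIdealSet X I), TzSClosed (ReesCon I hI).Quotient

/-- A congruence is a semilattice congruence if its quotient is a commutative
semigroup of idempotents. -/
def IsSemilatticeCon {X : Type*} [Semigroup X] (c : Con X) : Prop :=
  (∀ a b : c.Quotient, a * b = b * a) ∧ ∀ a : c.Quotient, a * a = a

/-- The smallest semilattice congruence `⇕` on `X`, the intersection of all
semilattice congruences. -/
def slCon (X : Type*) [Semigroup X] : Con X := sInf {c | IsSemilatticeCon c}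

theorem centerSet_mul_mem {X : Type*} [Semigroup X] {a b : X}
    (ha : a ∈ centerSet X) (hb : b ∈ centerSet X) : a * b ∈ centerSet X := fun t => by
  rw [mul_assoc, hb t, ← mul_assoc, ha t, mul_assoc]

/-- The ideal center `IZ(X) = {z ∈ Z(X) : zX ⊆ Z(X)}`, as a subsemigroup of `X`. -/
def idealCenter (X : Type*) [Semigroup X] : Subsemigroup X where
  carrier := {z | z ∈ centerSet X ∧ ∀ x : X, z * x ∈ centerSet X}
  mul_mem' := by
    rintro a b ⟨ha, ha'⟩ ⟨hb, hb'⟩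
    refine ⟨centerSet_mul_mem ha hb, fun x => ?_⟩
    have h : a * b * x = a * (b * x) := mul_assoc a b x
    rw [h]
    exact centerSet_mul_mem ha (hb' x)

/-- Evaluation of the semigroup polynomial with coefficients `a, l = [a₁, …, aₙ]`:
`x ↦ a * x * a₁ * x * ⋯ * x * aₙ` (computed in `X¹ = WithOne X`). -/
def polyEval {X : Type*} [Semigroup X] (a : WithOne X) (l : List (WithOne X)) (x : X) :
    WithOne X :=
  l.foldl (fun acc b => acc * (x : WithOne X) * b) a

/-- `f : X → X¹` is a semigroup polynomial of degree `d ≥ 1`. -/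
def IsSemigroupPolynomial {X : Type*} [Semigroup X] (f : X → WithOne X) (d : ℕ) : Prop :=
  1 ≤ d ∧ ∃ (a : WithOne X) (l : List (WithOne X)), l.length = d ∧ ∀ x, f x = polyEval a l x

/-- `X` is polybounded. -/
def Polybounded (X : Type*) [Semigroup X] : Prop :=
  ∃ (k : ℕ) (f : Fin k → X → WithOne X) (d : Fin k → ℕ) (b : Fin k → X),
    (∀ i, IsSemigroupPolynomial (f i) (d i)) ∧ ∀ x : X, ∃ i, f i x = (b i : WithOne X)

/-- `X` is polyfinite. -/
def Polyfinite (X : Type*) [Semigroup X] : Prop :=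
  ∃ (d : ℕ) (F : Set X), F.Finite ∧ ∀ x y : X,
    ∃ (f : X → WithOne X) (m : ℕ), m ≤ d ∧ IsSemigroupPolynomial f m ∧
      (∃ u ∈ F, f x = (u : WithOne X)) ∧ ∃ v ∈ F, f y = (v : WithOne X)

/-- `X` is `B`-centrobounded over `B ⊆ E(X)`: there is `n ≥ 1` such that for every
`e ∈ B` and all `x, y ∈ ⋂_{a ∈ B} H_a/a`, if `w` is the inverse of `y*e` in the group
`H_e` and `(x*e)*w ∈ H_e ∩ Z(X)`, then `((x*e)*w)ⁿ` is an idempotent. -/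
def Centrobounded {X : Type*} [Semigroup X] (B : Set X) : Prop :=
  ∃ n : ℕ, ∀ e ∈ B, ∀ x ∈ ⋂ a ∈ B, HeCoideal X a, ∀ y ∈ ⋂ a ∈ B, HeCoideal X a,
    ∀ w ∈ maxSubgroup X e, (y * e) * w = e → w * (y * e) = e →
      (x * e) * w ∈ maxSubgroup X e → (x * e) * w ∈ centerSet X →
        spow ((x * e) * w) n ∈ idemSet X

/-- `B` is an antichain in the natural partial order `e ≤ f ⇔ ef = fe = e` on idempotents. -/
def IsIdemAntichain {X : Type*} [Semigroup X] (B : Set X) : Prop :=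
  ∀ e ∈ B, ∀ f ∈ B, e ≠ f → ¬(e * f = e ∧ f * e = e) ∧ ¬(e * f = f ∧ f * e = f)

open Filter Topology

/-- If filters `n y` satisfy the axioms of neighbourhood filters of a `T₁` semigroup topology on
`Y`, then the image of an absolutely `T₁S`-closed semigroup in `Y` contains each of its limits. -/
theorem AbsolutelyT1SClosed.mem_range_of_nhds {X : Type u} [Semigroup X]
    (hX : AbsolutelyT1SClosed X) {Y : Type u} [Semigroup Y] (h : X →ₙ* Y) (n : Y → Filter Y)
    (hpure : pure ≤ n) (hopen : ∀ y, ∀ s ∈ n y, ∀ᶠ z in n y, s ∈ n z)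
    (hT1 : ∀ y z, y ≠ z → {z}ᶜ ∈ n y)
    (hmul : ∀ y z, Tendsto (fun p : Y × Y => p.1 * p.2) (n y ×ˢ n z) (n (y * z)))
    {p : Y} (hp : ∃ᶠ y in n p, y ∈ range h) : p ∈ range h := by
  let _ : TopologicalSpace Y := TopologicalSpace.mkOfNhds n
  have hn (y : Y) : 𝓝 y = n y := TopologicalSpace.nhds_mkOfNhds n y hpure hopen
  have : ContinuousMul Y := ⟨continuous_iff_continuousAt.2 fun ⟨y, z⟩ => by
    simpa only [ContinuousAt, nhds_prod_eq, hn] using hmul y z⟩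
  have : T1Space Y := ⟨fun z => ⟨isOpen_iff_mem_nhds.2 fun y hy => by
    rw [hn]; exact hT1 y z hy⟩⟩
  refine (hX Y h).closure_subset (mem_closure_iff_frequently.2 ?_)
  rwa [hn]

theorem AbsolutelyT1SClosed.of_surjective {X : Type u} [Semigroup X]
    (hX : AbsolutelyT1SClosed X) {Q : Type u} [Semigroup Q] (π : X →ₙ* Q)
    (hπ : Function.Surjective π) : AbsolutelyT1SClosed Q := by
  intro Y _ _ _ _ h
  have := hX Y (h.comp π)
  rwa [MulHom.coe_comp, hπ.range_comp] at this

section Prime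

/-- A subset of a semigroup is prime if a product belongs to it exactly when both factors do. -/
def IsPrimeSet {X : Type*} [Semigroup X] (P : Set X) : Prop :=
  ∀ x y, x * y ∈ P ↔ x ∈ P ∧ y ∈ P

/-- The indicator of a prime set as a homomorphism to `{0, 1}`. -/
noncomputable def IsPrimeSet.indicator {X : Type u} [Semigroup X] {P : Set X}
    (hP : IsPrimeSet P) : X →ₙ* WithZero PUnit.{u + 1} where
  toFun x := open Classical in if x ∈ P then 1 else 0
  map_mul' x y := by
    have := hP x y
    by_cases hx : x ∈ P <;> by_cases hy : y ∈ P <;> simp_all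

theorem IsPrimeSet.indicator_eq_iff {X : Type u} [Semigroup X] {P : Set X}
    (hP : IsPrimeSet P) (x y : X) : hP.indicator x = hP.indicator y ↔ (x ∈ P ↔ y ∈ P) := by
  by_cases hx : x ∈ P <;> by_cases hy : y ∈ P <;> simp_all [IsPrimeSet.indicator]

theorem IsPrimeSet.iInter {X ι : Type*} [Semigroup X] {P : ι → Set X}
    (hP : ∀ i, IsPrimeSet (P i)) : IsPrimeSet (⋂ i, P i) := fun x y => by
  simp only [mem_iInter, (hP _) x y, forall_and]

theorem IsPrimeSet.iUnion_of_monotone {X : Type*} [Semigroup X] {P : ℕ → Set X}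
    (hP : ∀ i, IsPrimeSet (P i)) (hmono : Monotone P) : IsPrimeSet (⋃ i, P i) := fun x y => by
  simp only [mem_iUnion, (hP _) x y]
  constructor
  · rintro ⟨i, hx, hy⟩
    exact ⟨⟨i, hx⟩, i, hy⟩
  · rintro ⟨⟨i, hx⟩, j, hy⟩
    exact ⟨max i j, hmono (le_max_left i j) hx, hmono (le_max_right i j) hy⟩

/-- An eventually constant pattern of memberships in prime sets is realized by an element of an
absolutely `T₁S`-closed semigroup. -/
theorem AbsolutelyT1SClosed.exists_forall_mem_iff {X : Type u} [Semigroup X]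
    (hX : AbsolutelyT1SClosed X) {ι : Type} {P : ι → Set X} (hP : ∀ i, IsPrimeSet (P i))
    (w : ℕ → X) (L : ι → ℕ) (hL : ∀ i, ∀ᶠ n in atTop, (w n ∈ P i ↔ w (L i) ∈ P i)) :
    ∃ x, ∀ i, x ∈ P i ↔ w (L i) ∈ P i := by
  let _ : TopologicalSpace (WithZero PUnit.{u + 1}) := ⊥
  have : DiscreteTopology (WithZero PUnit.{u + 1}) := ⟨rfl⟩
  let h : X →ₙ* (ι → WithZero PUnit.{u + 1}) :=
    { toFun := fun x i => (hP i).indicator x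
      map_mul' := fun x y => funext fun i => map_mul (hP i).indicator x y }
  have hlim : Tendsto (fun n => h (w n)) atTop (𝓝 fun i => (hP i).indicator (w (L i))) :=
    tendsto_pi_nhds.2 fun i => tendsto_nhds_of_eventually_eq <|
      (hL i).mono fun n hn => ((hP i).indicator_eq_iff _ _).2 hn
  obtain ⟨x, hx⟩ := (hX _ h).mem_of_tendsto hlim (Eventually.of_forall fun n => mem_range_self _)
  exact ⟨x, fun i => ((hP i).indicator_eq_iff _ _).1 (congrFun hx i)⟩

theorem AbsolutelyT1SClosed.not_strictAnti_prime {X : Type u} [Semigroup X]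
    (hX : AbsolutelyT1SClosed X) {P : ℕ → Set X} (hP : ∀ i, IsPrimeSet (P i)) (w : ℕ → X)
    (hw : ∀ m n, w m ∈ P n ↔ n ≤ m) : False := by
  obtain ⟨x, hx⟩ := hX.exists_forall_mem_iff (P := fun i : Option ℕ => i.elim (⋂ n, P n) P)
    (by rintro (_ | i); exacts [.iInter hP, hP i]) w (fun i => i.elim 0 id) (by
      rintro (_ | i)
      · refine Eventually.of_forall fun n => iff_of_false ?_ ?_ <;>
          simp only [Option.elim, mem_iInter, not_forall, hw]
        exacts [⟨n + 1, by lia⟩, ⟨1, by lia⟩]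
      · filter_upwards [eventually_ge_atTop i] with n hn
        simp [hw, hn])
  have h0 := hx none
  have h1 := fun n => (hx (some n)).2 (by simp [hw])
  have : w 0 ∈ ⋂ n, P n := h0.1 (mem_iInter.2 h1)
  simpa [hw] using mem_iInter.1 this 1

theorem AbsolutelyT1SClosed.not_strictMono_prime {X : Type u} [Semigroup X]
    (hX : AbsolutelyT1SClosed X) {P : ℕ → Set X} (hP : ∀ i, IsPrimeSet (P i))
    (hmono : Monotone P) (w : ℕ → X) (hw : ∀ m n, w m ∈ P n ↔ m ≤ n) : False := by
  obtain ⟨x, hx⟩ := hX.exists_forall_mem_iff (P := fun i : Option ℕ => i.elim (⋃ n, P n) P)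
    (by rintro (_ | i); exacts [.iUnion_of_monotone hP hmono, hP i]) w
    (fun i => i.elim 0 (· + 1)) (by
      rintro (_ | i)
      · refine Eventually.of_forall fun n => iff_of_true ?_ ?_ <;>
          simp only [Option.elim, mem_iUnion, hw]
        exacts [⟨n, le_rfl⟩, ⟨0, le_rfl⟩]
      · filter_upwards [eventually_gt_atTop i] with n hn
        simp [hw, hn])
  have h0 : x ∈ ⋃ n, P n := (hx none).2 (mem_iUnion.2 ⟨0, (hw 0 0).2 le_rfl⟩)
  obtain ⟨n, hn⟩ := mem_iUnion.1 h0
  have := (hw _ _).1 ((hx (some n)).1 hn)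
  simp at this

end Prime

/-- The filter of neighbourhoods of `y` when the family `T y` is declared to converge to `y`
along `F`. -/
def limitNhds {Y ι : Type*} (F : Filter ι) (T : Y → ι → Y) (y : Y) : Filter Y :=
  pure y ⊔ map (T y) F

theorem mem_limitNhds {Y ι : Type*} {F : Filter ι} {T : Y → ι → Y} {y : Y} {s : Set Y} :
    s ∈ limitNhds F T y ↔ y ∈ s ∧ ∀ᶠ i in F, T y i ∈ s := Iff.rfl

theorem AbsolutelyT1SClosed.mem_range_of_limitNhds {X : Type u} [Semigroup X]
    (hX : AbsolutelyT1SClosed X) {Y : Type u} [Semigroup Y] (h : X →ₙ* Y) {ι : Type*}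
    {F : Filter ι} {T : Y → ι → Y}
    (hT : ∀ y, ∀ᶠ i in F, ∀ᶠ j in F, T (T y i) j = T y i)
    (hT1 : ∀ y z, y ≠ z → ∀ᶠ i in F, T y i ≠ z)
    (hr : ∀ y z, Tendsto (fun i => y * T z i) F (limitNhds F T (y * z)))
    (hl : ∀ y z, Tendsto (fun i => T y i * z) F (limitNhds F T (y * z)))
    (hlr : ∀ y z, Tendsto (fun p : ι × ι => T y p.1 * T z p.2) (F ×ˢ F) (limitNhds F T (y * z)))
    {p : Y} (hp : ∃ᶠ i in F, T p i ∈ range h) : p ∈ range h := by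
  refine hX.mem_range_of_nhds h (limitNhds F T) (fun y => le_sup_left) ?_ ?_ ?_
    (Frequently.filter_mono (f := map (T p) F) (frequently_map.2 hp) le_sup_right)
  · rintro y s hs
    refine mem_limitNhds.2 ⟨hs, ?_⟩
    filter_upwards [hT y, (mem_limitNhds.1 hs).2] with i hi his
    refine mem_limitNhds.2 ⟨his, hi.mono fun j hj => ?_⟩
    rwa [hj]
  · exact fun y z hyz => mem_limitNhds.2 ⟨hyz, hT1 y z hyz⟩
  · intro y z
    have hself : pure (y * z) ≤ limitNhds F T (y * z) := le_sup_left
    rw [limitNhds, limitNhds, sup_prod, prod_sup, prod_sup, pure_prod, pure_prod, prod_pure,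
      prod_map_map_eq, map_pure, Filter.map_map]
    refine Tendsto.sup (Tendsto.sup (tendsto_pure_left.2 fun s hs => hself hs) ?_)
      (Tendsto.sup ?_ ?_)
    · exact tendsto_map'_iff.2 (hr y z)
    · exact tendsto_map'_iff.2 (hl y z)
    · exact tendsto_map'_iff.2 (hlr y z)

section Antichain

/-- The sets in `ι` under intersection, extended by an infinitesimal element of square zero on
which a set acts as its indicator at the ultrafilter `F`. -/
@[ext]
structure DualSet {ι : Type*} (F : Ultrafilter ι) where
  /-- The finite part. -/
  set : Set ι
  /-- The coefficient of the infinitesimal element. -/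
  eps : Prop

namespace DualSet

variable {ι : Type*} {F : Ultrafilter ι}

instance : Mul (DualSet F) where
  mul a b := ⟨a.set ∩ b.set, (a.set ∈ F ∧ b.eps) ∨ (b.set ∈ F ∧ a.eps)⟩

@[simp] theorem set_mul (a b : DualSet F) : (a * b).set = a.set ∩ b.set := rfl

@[simp] theorem eps_mul (a b : DualSet F) :
    (a * b).eps = ((a.set ∈ F ∧ b.eps) ∨ (b.set ∈ F ∧ a.eps)) := rfl

instance : CommSemigroup (DualSet F) where
  mul_assoc a b c := by
    refine DualSet.ext (inter_assoc _ _ _) (propext ?_)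
    have h (s t : Set ι) : s ∩ t ∈ F ↔ s ∈ F ∧ t ∈ F := Filter.inter_mem_iff
    simp only [set_mul, eps_mul, h]
    tauto
  mul_comm a b := DualSet.ext (inter_comm _ _) (propext or_comm)

/-- Sets as elements of `DualSet F`. -/
def ofSet (F : Ultrafilter ι) (s : Set ι) : DualSet F := ⟨s, False⟩

@[simp] theorem set_ofSet (s : Set ι) : (ofSet F s).set = s := rfl

@[simp] theorem eps_ofSet (s : Set ι) : (ofSet F s).eps = False := rfl

theorem ofSet_mul_ofSet (s t : Set ι) : ofSet F s * ofSet F t = ofSet F (s ∩ t) := by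
  ext <;> simp

open Classical in
/-- The family converging to `y`: the singletons if the finite part of `y` is empty. -/
noncomputable def approx (y : DualSet F) (i : ι) : DualSet F :=
  if y.set = ∅ then ofSet F {i} else y

theorem approx_of_eq {y : DualSet F} (hy : y.set = ∅) : approx y = fun i => ofSet F {i} :=
  funext fun _ => if_pos hy

theorem approx_of_ne {y : DualSet F} (hy : y.set ≠ ∅) : approx y = fun _ => y :=
  funext fun _ => if_neg hy

theorem singleton_notMem (hF : (F : Filter ι) ≤ cofinite) (i : ι) : {i} ∉ F := fun hi =>
  F.compl_notMem_iff.2 hi (hF (finite_singleton i).compl_mem_cofinite)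

theorem tendsto_approx_mul (hF : (F : Filter ι) ≤ cofinite) (a b : DualSet F) :
    Tendsto (fun i => approx a i * b) F (limitNhds (F : Filter ι) approx (a * b)) := by
  have hpure : pure (a * b) ≤ limitNhds (F : Filter ι) approx (a * b) := le_sup_left
  by_cases ha : a.set = ∅
  · have h0 : (a * b).set = ∅ := by simp [ha]
    rw [approx_of_eq ha]
    by_cases hb : b.set ∈ F
    · refine Tendsto.mono_right ?_ (le_sup_right : _ ≤ limitNhds (F : Filter ι) approx (a * b))
      refine tendsto_map.congr' ?_
      filter_upwards [hb] with i hi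
      ext <;> simp [approx_of_eq h0, singleton_notMem hF]
      rintro rfl
      exact hi
    · refine (tendsto_pure.2 ?_).mono_right hpure
      filter_upwards [F.compl_mem_iff_notMem.2 hb] with i hi
      have : ∅ ∉ F := F.empty_notMem
      ext <;> simp [ha, hb, this, singleton_notMem hF]
      rintro rfl
      exact hi
  · rw [approx_of_ne ha]
    exact (tendsto_pure.2 (Eventually.of_forall fun _ => rfl)).mono_right hpure

theorem tendsto_approx_mul_approx (hF : (F : Filter ι) ≤ cofinite) (a b : DualSet F) :
    Tendsto (fun p : ι × ι => approx a p.1 * approx b p.2) (F ×ˢ F)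
      (limitNhds (F : Filter ι) approx (a * b)) := by
  by_cases hb : b.set = ∅
  · by_cases ha : a.set = ∅
    · have h0 : (a * b).set = ∅ := by simp [ha]
      rw [approx_of_eq ha, approx_of_eq hb]
      intro s hs
      obtain ⟨hs0, hs1⟩ := mem_limitNhds.1 hs
      have hab : a * b = ofSet F ∅ := by
        have : ∅ ∉ F := F.empty_notMem
        ext <;> simp [ha, hb, this]
      rw [hab] at hs0
      refine mem_map.2 ((hs1.prod_inl (F : Filter ι)).mono fun p hp => ?_)
      simp only [approx_of_eq h0] at hp
      change ofSet F {p.1} * ofSet F {p.2} ∈ s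
      rw [ofSet_mul_ofSet]
      by_cases hpp : p.1 = p.2
      · rwa [← hpp, inter_self]
      · rwa [singleton_inter_eq_empty.2 (by simpa using hpp)]
    · rw [approx_of_ne ha]
      simp only [mul_comm a]
      exact (tendsto_approx_mul hF b a).comp tendsto_snd
  · rw [approx_of_ne hb]
    exact (tendsto_approx_mul hF a b).comp tendsto_fst

end DualSet

theorem AbsolutelyT1SClosed.not_antichain_prime {X : Type u} [Semigroup X]
    (hX : AbsolutelyT1SClosed X) {P : ℕ → Set X} (hP : ∀ i, IsPrimeSet (P i)) (w : ℕ → X)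
    (hw : ∀ m n, w m ∈ P n ↔ m = n) : False := by
  let F : Ultrafilter (ULift.{u} ℕ) := hyperfilter _
  have hF : (F : Filter (ULift.{u} ℕ)) ≤ cofinite := hyperfilter_le_cofinite
  let h : X →ₙ* DualSet F :=
    { toFun := fun x => .ofSet F {i | x ∈ P i.down}
      map_mul' := fun x y => by
        rw [DualSet.ofSet_mul_ofSet]
        exact congrArg _ (ext fun i => hP i.down x y) }
  have hmem : (⟨∅, True⟩ : DualSet F) ∈ range h := by
    refine hX.mem_range_of_limitNhds (F := (F : Filter (ULift.{u} ℕ))) h (T := DualSet.approx)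
      ?_ ?_ ?_ (DualSet.tendsto_approx_mul hF) (DualSet.tendsto_approx_mul_approx hF) ?_
    · refine fun y => Eventually.of_forall fun i => Eventually.of_forall fun j => ?_
      have : (DualSet.approx y i).set ≠ ∅ := by
        by_cases hy : y.set = ∅
        · simp [DualSet.approx_of_eq hy]
        · simpa [DualSet.approx_of_ne hy] using hy
      rw [DualSet.approx_of_ne this]
    · intro y z hyz
      by_cases hy : y.set = ∅
      · have hz : {i : ULift.{u} ℕ | DualSet.ofSet F {i} = z}.Subsingleton := fun i hi j hj => by
          simpa using congrArg DualSet.set (hi.trans hj.symm)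
        simp only [DualSet.approx_of_eq hy]
        exact hF hz.finite.compl_mem_cofinite
      · exact Eventually.of_forall fun i => by rwa [DualSet.approx_of_ne hy]
    · intro y z
      simpa only [mul_comm y] using DualSet.tendsto_approx_mul hF z y
    · refine (Eventually.of_forall fun i => ⟨w i.down, ?_⟩).frequently
      rw [DualSet.approx_of_eq rfl]
      refine congrArg (DualSet.ofSet F) (ext fun j => ?_)
      simp only [mem_ofPred_eq, hw, mem_singleton_iff, ULift.ext_iff, eq_comm]
  obtain ⟨x, hx⟩ := hmem
  have := congrArg DualSet.eps hx
  simp [h] at this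

end Antichain

section Null

variable {M : Type*} [Monoid M]

theorem monomial_mul_monomial {b : ℕ → M} {o : M} (hbc : ∀ i c, b i * c = c * b i)
    (hbb : ∀ i j, b i * b j = o) (ho : ∀ c, o * c = o) (i j : ℕ) (c d : M) :
    b i * c * (b j * d) = o := by
  rw [mul_assoc, ← mul_assoc c, ← hbc, mul_assoc, ← mul_assoc, hbb, ho]

/-- The germs along `F` of the constant families and of the right multiples of `b`, where `b` is
a central family whose pairwise products are all equal to a zero `o`. -/
def monomialGerms (F : Ultrafilter ℕ) (b : ℕ → M) (o : M) (ho : ∀ c, o * c = o)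
    (hbc : ∀ i c, b i * c = c * b i) (hbb : ∀ i j, b i * b j = o) :
    Subsemigroup (Germ (F : Filter ℕ) M) where
  carrier := {f | (∃ c : M, f = (↑c : Germ (F : Filter ℕ) M)) ∨
    ∃ c : M, f = (↑(fun i => b i * c) : Germ (F : Filter ℕ) M)}
  mul_mem' := by
    rintro _ _ (⟨c, rfl⟩ | ⟨c, rfl⟩) (⟨d, rfl⟩ | ⟨d, rfl⟩)
    · exact .inl ⟨c * d, rfl⟩
    · refine .inr ⟨c * d, congrArg Germ.ofFun (funext fun i => ?_)⟩
      change c * (b i * d) = b i * (c * d)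
      rw [← mul_assoc, ← hbc, mul_assoc]
    · refine .inr ⟨c * d, congrArg Germ.ofFun (funext fun i => mul_assoc _ _ _)⟩
    · exact .inl ⟨o, congrArg Germ.ofFun
        (funext fun i => monomial_mul_monomial hbc hbb ho i i c d)⟩

namespace monomialGerms

variable {F : Ultrafilter ℕ} {b : ℕ → M} {o : M} {ho : ∀ c, o * c = o}
  {hbc : ∀ i c, b i * c = c * b i} {hbb : ∀ i j, b i * b j = o}

local notation "Y" => monomialGerms F b o ho hbc hbb

/-- The constant germs. -/
def con : M →ₙ* Y where
  toFun c := ⟨(↑c : Germ (F : Filter ℕ) M), .inl ⟨c, rfl⟩⟩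
  map_mul' _ _ := rfl

/-- The germ of the family `b i * c`. -/
def mono (c : M) : Y := ⟨(↑(fun i => b i * c) : Germ (F : Filter ℕ) M), .inr ⟨c, rfl⟩⟩

theorem eq_con_or_mono (y : Y) : (∃ c, y = con c) ∨ ∃ c, y = mono c := by
  obtain ⟨_, ⟨c, rfl⟩ | ⟨c, rfl⟩⟩ := y
  exacts [.inl ⟨c, rfl⟩, .inr ⟨c, rfl⟩]

/-- The constant germs given by the values of a representative of `y`. -/
noncomputable def approx (y : Y) (i : ℕ) : Y := con (Quotient.out y.1 i)

variable (F ho hbc hbb) in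
theorem approx_con (c : M) : approx (con c : Y) =ᶠ[F] fun _ => con c := by
  have : (Quotient.out (con c : Y).1) =ᶠ[F] fun _ => c :=
    Germ.coe_eq.1 (Quotient.out_eq (con c : Y).1)
  exact this.fun_comp con

variable (F ho hbc hbb) in
theorem approx_mono (c : M) : approx (mono c : Y) =ᶠ[F] fun i => con (b i * c) := by
  have : (Quotient.out (mono c : Y).1) =ᶠ[F] fun i => b i * c :=
    Germ.coe_eq.1 (Quotient.out_eq (mono c : Y).1)
  exact this.fun_comp con

theorem con_mul_mono (c d : M) : (con c * mono d : Y) = mono (c * d) := by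
  refine Subtype.ext (congrArg Germ.ofFun (funext fun i => ?_))
  change c * (b i * d) = b i * (c * d)
  rw [← mul_assoc, ← hbc, mul_assoc]

theorem mono_mul_con (c d : M) : (mono c * con d : Y) = mono (c * d) :=
  Subtype.ext (congrArg Germ.ofFun (funext fun _ => mul_assoc _ _ _))

theorem mono_mul_mono (c d : M) : (mono c * mono d : Y) = con o :=
  Subtype.ext (congrArg Germ.ofFun (funext fun i => monomial_mul_monomial hbc hbb ho i i c d))

theorem mono_eq_con {c : M} (h : ∀ i, b i * c = o) : (mono c : Y) = con o :=
  Subtype.ext (congrArg Germ.ofFun (funext h))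

theorem tendsto_const_limitNhds {α : Type*} {l : Filter α} {f : α → Y} {y : Y}
    (h : ∀ᶠ i in l, f i = y) : Tendsto f l (limitNhds (F : Filter ℕ) approx y) :=
  (tendsto_pure.2 h).mono_right le_sup_left

theorem tendsto_mono_limitNhds {f : ℕ → Y} {c : M}
    (h : ∀ᶠ i in F, f i = con (b i * c)) :
    Tendsto f F (limitNhds (F : Filter ℕ) approx (mono c)) := by
  refine (tendsto_map.congr' ?_).mono_right
    (le_sup_right : _ ≤ limitNhds (F : Filter ℕ) approx (mono c : Y))
  filter_upwards [h, approx_mono F ho hbc hbb c] with i h1 h2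
  rw [h1, h2]

theorem eventually_approx_ne {y z : Y} (hyz : y ≠ z) : ∀ᶠ i in F, approx y i ≠ z := by
  by_contra hcon
  have hev : ∀ᶠ i in F, approx y i = z := by
    refine Ultrafilter.frequently_iff_eventually.1 ?_
    exact (not_eventually.1 hcon).mono fun _ h => not_not.1 h
  obtain ⟨i₀, hi₀⟩ := hev.exists
  refine hyz (Subtype.ext ?_)
  rw [← hi₀, ← Quotient.out_eq y.1]
  refine Quotient.sound ?_
  filter_upwards [hev] with i hi
  exact Germ.const_inj.1 (congrArg Subtype.val (hi.trans hi₀.symm))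

theorem tendsto_mul_approx (y z : Y) :
    Tendsto (fun i => y * approx z i) F (limitNhds (F : Filter ℕ) approx (y * z)) := by
  obtain ⟨d, rfl⟩ | ⟨d, rfl⟩ := eq_con_or_mono z
  · exact tendsto_const_limitNhds ((approx_con F ho hbc hbb d).mono fun i hi => congrArg (y * ·) hi)
  · obtain ⟨c, rfl⟩ | ⟨c, rfl⟩ := eq_con_or_mono y
    · rw [con_mul_mono]
      refine tendsto_mono_limitNhds ((approx_mono F ho hbc hbb d).mono fun i hi => ?_)
      rw [hi, ← map_mul, ← mul_assoc, ← hbc, mul_assoc]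
    · rw [mono_mul_mono]
      refine tendsto_const_limitNhds ((approx_mono F ho hbc hbb d).mono fun i hi => ?_)
      rw [hi, mono_mul_con]
      exact mono_eq_con fun j => by rw [← mul_assoc, monomial_mul_monomial hbc hbb ho]

theorem tendsto_approx_mul (y z : Y) :
    Tendsto (fun i => approx y i * z) F (limitNhds (F : Filter ℕ) approx (y * z)) := by
  obtain ⟨c, rfl⟩ | ⟨c, rfl⟩ := eq_con_or_mono y
  · exact tendsto_const_limitNhds ((approx_con F ho hbc hbb c).mono fun i hi => congrArg (· * z) hi)
  · obtain ⟨d, rfl⟩ | ⟨d, rfl⟩ := eq_con_or_mono z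
    · rw [mono_mul_con]
      refine tendsto_mono_limitNhds ((approx_mono F ho hbc hbb c).mono fun i hi => ?_)
      rw [hi, ← map_mul, mul_assoc]
    · rw [mono_mul_mono]
      refine tendsto_const_limitNhds ((approx_mono F ho hbc hbb c).mono fun i hi => ?_)
      rw [hi, con_mul_mono]
      refine mono_eq_con fun j => ?_
      rw [← mul_assoc, ← mul_assoc, hbb, ho, ho]

theorem tendsto_approx_mul_approx (y z : Y) :
    Tendsto (fun p : ℕ × ℕ => approx y p.1 * approx z p.2) (F ×ˢ F)
      (limitNhds (F : Filter ℕ) approx (y * z)) := by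
  obtain ⟨c, rfl⟩ | ⟨c, rfl⟩ := eq_con_or_mono y
  · refine ((tendsto_mul_approx (con c) z).comp tendsto_snd).congr' ?_
    filter_upwards [(approx_con F ho hbc hbb c).prod_inl (F : Filter ℕ)] with p hp
    rw [hp, Function.comp_apply]
  · obtain ⟨d, rfl⟩ | ⟨d, rfl⟩ := eq_con_or_mono z
    · refine ((tendsto_approx_mul (mono c) (con d)).comp tendsto_fst).congr' ?_
      filter_upwards [(approx_con F ho hbc hbb d).prod_inr (F : Filter ℕ)] with p hp
      rw [hp, Function.comp_apply]
    · rw [mono_mul_mono]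
      refine tendsto_const_limitNhds ?_
      filter_upwards [(approx_mono F ho hbc hbb c).prod_inl (F : Filter ℕ),
        (approx_mono F ho hbc hbb d).prod_inr (F : Filter ℕ)] with p h1 h2
      rw [h1, h2, ← map_mul, monomial_mul_monomial hbc hbb ho]

end monomialGerms

theorem AbsolutelyT1SClosed.not_null_family {X : Type u} [Semigroup X]
    (hX : AbsolutelyT1SClosed X) {M : Type u} [Monoid M] (ψ : X →ₙ* M) {o : M}
    (ho : ∀ c, o * c = o) (a : ℕ → X) (hinj : Function.Injective fun i => ψ (a i))
    (hac : ∀ i c, ψ (a i) * c = c * ψ (a i)) (haa : ∀ i j, ψ (a i) * ψ (a j) = o) : False := by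
  let F : Ultrafilter ℕ := hyperfilter ℕ
  let con := monomialGerms.con (F := F) (ho := ho) (hbc := hac) (hbb := haa)
  let p := monomialGerms.mono (F := F) (ho := ho) (hbc := hac) (hbb := haa) 1
  have hmem : p ∈ range (con.comp ψ) := by
    refine hX.mem_range_of_limitNhds (F := (F : Filter ℕ)) (con.comp ψ)
      (T := monomialGerms.approx)
      (fun y => Eventually.of_forall fun i => monomialGerms.approx_con F ho hac haa _)
      (fun y z hyz => monomialGerms.eventually_approx_ne hyz)
      monomialGerms.tendsto_mul_approx monomialGerms.tendsto_approx_mul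
      monomialGerms.tendsto_approx_mul_approx ?_
    refine Eventually.frequently
      ((monomialGerms.approx_mono F ho hac haa 1).mono fun i hi => ⟨a i, ?_⟩)
    exact (congrArg con (mul_one _)).symm.trans hi.symm
  obtain ⟨x, hx⟩ := hmem
  have hev : ∀ᶠ i in F, ψ x = ψ (a i) * 1 := Quotient.exact (congrArg Subtype.val hx)
  have hfin : {i | ψ (a i) = ψ x}.Finite :=
    Set.Subsingleton.finite fun i hi j hj => hinj (hi.trans hj.symm)
  have hne : ∀ᶠ i in F, ψ (a i) ≠ ψ x := hyperfilter_le_cofinite hfin.compl_mem_cofinite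
  obtain ⟨i, h1, h2⟩ := (hev.and hne).exists
  exact h2 (by rw [h1, mul_one])

/-- The quotient homomorphism of a semigroup onto its Rees quotient. -/
def reesMk {X : Type*} [Semigroup X] {J : Set X} (hJ : IsIdealSet X J) :
    X →ₙ* (ReesCon J hJ).Quotient := ⟨(↑), fun _ _ => rfl⟩

theorem reesMk_eq_iff {X : Type*} [Semigroup X] {J : Set X} (hJ : IsIdealSet X J) {x y : X} :
    reesMk hJ x = reesMk hJ y ↔ x = y ∨ (x ∈ J ∧ y ∈ J) := Con.eq _

theorem reesMk_surjective {X : Type*} [Semigroup X] {J : Set X} (hJ : IsIdealSet X J) :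
    Function.Surjective (reesMk hJ) := Quotient.mk''_surjective

theorem AbsolutelyT1SClosed.not_null_family_mod {X : Type u} [Semigroup X]
    (hX : AbsolutelyT1SClosed X) {J : Set X} (hJ : IsIdealSet X J) (a : ℕ → X)
    (hinj : Function.Injective a) (hac : ∀ i, a i ∈ centerSet X) (haJ : ∀ i, a i ∉ J)
    (haa : ∀ i j, a i * a j ∈ J) : False := by
  let ψ : X →ₙ* WithOne (ReesCon J hJ).Quotient := WithOne.coeMulHom.comp (reesMk hJ)
  have hψ (x y : X) : ψ x = ψ y ↔ x = y ∨ (x ∈ J ∧ y ∈ J) :=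
    WithOne.coe_inj.trans (reesMk_eq_iff hJ)
  have hcases (c : WithOne (ReesCon J hJ).Quotient) : c = 1 ∨ ∃ x, c = ψ x := by
    induction c with
    | one => exact .inl rfl
    | coe q => obtain ⟨x, rfl⟩ := reesMk_surjective hJ q; exact .inr ⟨x, rfl⟩
  refine hX.not_null_family ψ (o := ψ (a 0 * a 0)) ?_ a ?_ ?_ ?_
  · intro c
    obtain rfl | ⟨x, rfl⟩ := hcases c
    · exact mul_one _
    · rw [← map_mul, hψ]
      exact .inr ⟨(hJ _ (haa 0 0) x).1, haa 0 0⟩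
  · intro i j hij
    exact ((hψ _ _).1 hij).elim (fun h => hinj h) fun h => (haJ i h.1).elim
  · intro i c
    obtain rfl | ⟨x, rfl⟩ := hcases c
    · rw [mul_one, one_mul]
    · rw [← map_mul, ← map_mul, hac i x]
  · intro i j
    rw [← map_mul, hψ]
    exact .inr ⟨haa i j, haa 0 0⟩

end Null

section Power

variable {X : Type*} [Semigroup X]

theorem spow_mul_spow (a : X) (m n : ℕ) : spow a m * spow a n = spow a (m + n + 1) := by
  induction n with
  | zero => rfl
  | succ n ih => exact (mul_assoc _ _ _).symm.trans (congrArg (· * a) ih)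

theorem mul_spow {x : X} (hx : x ∈ centerSet X) (z : X) (n : ℕ) :
    spow (x * z) n = spow x n * spow z n := by
  induction n with
  | zero => rfl
  | succ n ih =>
    change spow (x * z) n * (x * z) = spow x n * x * (spow z n * z)
    rw [ih, mul_assoc, mul_assoc, ← mul_assoc (spow z n), ← hx, mul_assoc]

theorem spow_mem_centerSet {x : X} (hx : x ∈ centerSet X) (n : ℕ) : spow x n ∈ centerSet X := by
  induction n with
  | zero => exact hx
  | succ n ih => exact centerSet_mul_mem ih hx

theorem map_spow {Y : Type*} [Semigroup Y] (h : X →ₙ* Y) (x : X) (n : ℕ) :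
    h (spow x n) = spow (h x) n := by
  induction n with
  | zero => rfl
  | succ n ih => exact (map_mul h _ _).trans (congrArg (· * h x) ih)

/-- The central elements having `e` among their powers. -/
def centralRoots (X : Type*) [Semigroup X] (e : X) : Set X :=
  {z | z ∈ centerSet X ∧ ∃ n, spow z n = e}

theorem eq_zero_of_eq_mul {o x u : X} {n : ℕ} (ho : ∀ y, o * y = o ∧ y * o = o)
    (hu : spow u n = o) (hx : x = x * u) : x = o := by
  have h (k : ℕ) : x = x * spow u k := by
    induction k with
    | zero => exact hx
    | succ k ih => rw [spow, ← mul_assoc, ← ih, ← hx]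
  rw [h n, hu, (ho x).2]

theorem centralRoots_zero_mul_mem {o b z : X} (ho : ∀ y, o * y = o ∧ y * o = o)
    (hb : b ∈ centralRoots X o) (hz : z ∈ centerSet X) : b * z ∈ centralRoots X o := by
  obtain ⟨hbc, n, hn⟩ := hb
  exact ⟨centerSet_mul_mem hbc hz, n, by rw [mul_spow hbc, hn, (ho _).1]⟩

theorem exists_infinite_subset_centralRoots {o : X} (ho : ∀ y, o * y = o ∧ y * o = o)
    (hinf : (centralRoots X o).Infinite) :
    ∃ B ⊆ centralRoots X o, B.Infinite ∧ ∀ a ∈ B, ((a * ·) '' B).Finite := by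
  set N := centralRoots X o with hN
  by_cases hfin : ∀ a ∈ N, ((a * ·) '' N).Finite
  · exact ⟨N, Subset.rfl, hinf, hfin⟩
  push Not at hfin
  obtain ⟨a, ha, hainf⟩ := hfin
  have hex : ∃ n, ((spow a n * ·) '' N).Finite := by
    obtain ⟨n, hn⟩ := ha.2
    refine ⟨n, (finite_singleton o).subset ?_⟩
    rintro _ ⟨z, -, rfl⟩
    change spow a n * z = o
    rw [hn, (ho z).1]
  have hup (m n : ℕ) (hmn : m ≤ n) (hm : ((spow a m * ·) '' N).Finite) :
      ((spow a n * ·) '' N).Finite := by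
    induction n, hmn using Nat.le_induction with
    | base => exact hm
    | succ n _ ih =>
      refine ih.subset ?_
      rintro _ ⟨z, hz, rfl⟩
      exact ⟨a * z, centralRoots_zero_mul_mem ho ha hz.1, (mul_assoc _ _ _).symm⟩
  classical
  obtain ⟨k, hk⟩ : ∃ k, Nat.find hex = k + 1 := Nat.exists_eq_succ_of_ne_zero fun h => by
    have := Nat.find_spec hex
    rw [h] at this
    exact hainf this
  have hk1 : ((spow a (k + 1) * ·) '' N).Finite := hk ▸ Nat.find_spec hex
  have hk0 : ((spow a k * ·) '' N).Infinite := Nat.find_min hex (by lia)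
  have hac := spow_mem_centerSet ha.1
  refine ⟨(spow a k * ·) '' N, ?_, hk0, ?_⟩
  · rintro _ ⟨z, hz, rfl⟩
    change spow a k * z ∈ _
    rw [hac]
    exact centralRoots_zero_mul_mem ho hz (hac k)
  · rintro _ ⟨z, hz, rfl⟩
    refine ((hup (k + 1) (k + k + 1) (by lia) hk1).image (z * ·)).subset ?_
    rintro _ ⟨_, ⟨w, hw, rfl⟩, rfl⟩
    refine ⟨_, ⟨w, hw, rfl⟩, ?_⟩
    change z * (spow a (k + k + 1) * w) = spow a k * z * (spow a k * w)
    rw [hac k z, mul_assoc, ← mul_assoc (spow a k), spow_mul_spow]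

theorem exists_seq_mul_eq {B : Set X} (hB : B.Infinite) (hfin : ∀ a ∈ B, ((a * ·) '' B).Finite)
    (o : X) : ∃ a c : ℕ → X, Function.Injective a ∧ (∀ i, a i ∈ B ∧ a i ≠ o) ∧
      ∀ i j, i < j → a i * a j = c i := by
  have hne : (cofinite ⊓ 𝓟 B).NeBot := hB.cofinite_inf_principal_neBot
  let F := Ultrafilter.of (cofinite ⊓ 𝓟 B)
  have hF : (F : Filter X) ≤ cofinite ⊓ 𝓟 B := Ultrafilter.of_le _
  have hFB : ∀ᶠ z in F, z ∈ B := hF.trans inf_le_right (mem_principal_self B)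
  have hF1 (x : X) : ∀ᶠ z in F, z ≠ x :=
    hF.trans inf_le_left (finite_singleton x).compl_mem_cofinite
  have hc (x : X) : ∃ c, x ∈ B → ∀ᶠ z in F, x * z = c := by
    by_cases hx : x ∈ B
    · have : ∀ᶠ z in F, ∃ c ∈ (x * ·) '' B, x * z = c :=
        hFB.mono fun z hz => ⟨_, ⟨z, hz, rfl⟩, rfl⟩
      obtain ⟨c, -, hc⟩ := (Ultrafilter.eventually_exists_mem_iff (hfin x hx)).1 this
      exact ⟨c, fun _ => hc⟩
    · exact ⟨x, fun h => (hx h).elim⟩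
  choose c hc using hc
  obtain ⟨a, haB, har⟩ := exists_seq_of_forall_finset_exists (fun x => x ∈ B ∧ x ≠ o)
    (fun x y => x * y = c x ∧ y ≠ x) fun s hs => by
      have : ∀ᶠ z in F, ∀ x ∈ s, x * z = c x ∧ z ≠ x :=
        (Filter.eventually_all_finset s).2 fun x hx => (hc x (hs x hx).1).and (hF1 x)
      obtain ⟨z, h1, h2, h3⟩ := (hFB.and ((hF1 o).and this)).exists
      exact ⟨z, ⟨h1, h2⟩, h3⟩
  refine ⟨a, c ∘ a, .of_lt_imp_ne fun i j hij => (har i j hij).2.symm, haB,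
    fun i j hij => (har i j hij).1⟩

end Power

theorem exists_increasing_or_decreasing_or_antichain_subseq {α : Type*} (r : α → α → Prop)
    [IsTrans α r] (f : ℕ → α) : ∃ g : ℕ → ℕ, StrictMono g ∧
      ((∀ m n, m < n → r (f (g m)) (f (g n))) ∨ (∀ m n, m < n → r (f (g n)) (f (g m))) ∨
        ∀ m n, m ≠ n → ¬ r (f (g m)) (f (g n))) := by
  obtain ⟨g, hg | hg⟩ := exists_increasing_or_nonincreasing_subseq r f
  · exact ⟨g, g.strictMono, .inl hg⟩
  obtain ⟨g', hg' | hg'⟩ := exists_increasing_or_nonincreasing_subseq (Function.swap r) (f ∘ g)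
  · exact ⟨g ∘ g', g.strictMono.comp g'.strictMono, .inr (.inl hg')⟩
  · refine ⟨g ∘ g', g.strictMono.comp g'.strictMono, .inr (.inr fun m n hmn => ?_)⟩
    obtain h | h := hmn.lt_or_gt
    exacts [hg _ _ (g'.strictMono h), hg' _ _ h]

theorem AbsolutelyT1SClosed.finite_centralRoots_zero {X : Type u} [Semigroup X]
    (hX : AbsolutelyT1SClosed X) {o : X} (ho : ∀ y, o * y = o ∧ y * o = o) :
    (centralRoots X o).Finite := by
  by_contra hinf
  obtain ⟨B, hBN, hB, hfin⟩ := exists_infinite_subset_centralRoots ho hinf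
  obtain ⟨a, c, hinj, ha, hac⟩ := exists_seq_mul_eq hB hfin o
  let L : Set X := {u | ∃ b ∈ centralRoots X o, u = b ∨ ∃ q, u = b * q}
  have hLo {u x : X} (hu : u ∈ L) (hx : x = x * u) : x = o := by
    obtain ⟨b, ⟨hbc, n, hn⟩, rfl | ⟨q, rfl⟩⟩ := hu
    · exact eq_zero_of_eq_mul ho hn hx
    · exact eq_zero_of_eq_mul ho (n := n) (by rw [mul_spow hbc, hn, (ho _).1]) hx
  have hLmul {u : X} (hu : u ∈ L) (x : X) : u * x ∈ L := by
    obtain ⟨b, hb, rfl | ⟨q, rfl⟩⟩ := hu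
    exacts [⟨u, hb, .inr ⟨x, rfl⟩⟩, ⟨b, hb, .inr ⟨q * x, mul_assoc _ _ _⟩⟩]
  let D (x y : X) : Prop := ∃ u ∈ L, x = y * u
  have : IsTrans X D := ⟨by
    rintro _ _ z ⟨u, -, rfl⟩ ⟨v, hv, rfl⟩
    exact ⟨v * u, hLmul hv u, mul_assoc _ _ _⟩⟩
  obtain ⟨g, hg, hD⟩ := exists_increasing_or_decreasing_or_antichain_subseq D a
  have hcent (i : ℕ) : a i ∈ centerSet X := (hBN (ha i).1).1
  have hnull (g' : ℕ → ℕ) (hg' : StrictMono g') (h : ∀ i, c (g' i) = o)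
      (hsq : ∀ i, a (g' i) * a (g' i) = o) : False := by
    refine hX.not_null_family_mod (J := {o}) ?_ (a ∘ g') (hinj.comp hg'.injective)
      (fun i => hcent _) (fun i => (ha _).2) fun i j => ?_
    · intro x hx y
      rw [mem_singleton_iff.1 hx]
      exact ho y
    · change a (g' i) * a (g' j) = o
      obtain hij | rfl | hij := lt_trichotomy i j
      · rw [hac _ _ (hg' hij), h]
      · exact hsq i
      · rw [hcent, hac _ _ (hg' hij), h]
  obtain hD | hD | hD := hD
  · have h (i : ℕ) : c (g i) = o := by
      obtain ⟨u, hu, h⟩ := hD (i + 1) (i + 2) (by lia)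
      refine hLo hu ?_
      conv_lhs => rw [← hac _ _ (hg (Nat.lt_succ_self i)), h, ← mul_assoc, hac _ _ (hg (by lia))]
    refine hnull g hg h fun i => ?_
    obtain ⟨u, hu, hi⟩ := hD i (i + 1) (by lia)
    conv_lhs => rw [hi, ← hi]; arg 2; rw [hi]
    rw [← mul_assoc, hac _ _ (hg (Nat.lt_succ_self i)), h, (ho u).1]
  · have h (i : ℕ) : c (g i) = o := by
      obtain ⟨u, hu, h⟩ := hD (i + 1) (i + 2) (by lia)
      refine hLo hu ?_
      conv_lhs => rw [← hac (g i) (g (i + 2)) (hg (by lia)), h, ← mul_assoc,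
        hac _ _ (hg (Nat.lt_succ_self i))]
    refine hnull (fun i => g (i + 1)) (fun i j hij => hg (by lia)) (fun i => h _) fun i => ?_
    obtain ⟨u, hu, hi⟩ := hD 0 (i + 1) (by lia)
    conv_lhs => arg 2; rw [hi]
    rw [← mul_assoc, hcent, hac _ _ (hg (Nat.succ_pos i)), h, (ho u).1]
  · let J : Set X := {x | ∃ i j, x = a (g i) * a (g j) ∨ ∃ q, x = a (g i) * (a (g j) * q)}
    refine hX.not_null_family_mod (J := J) ?_ (a ∘ g) (hinj.comp hg.injective)
      (fun i => hcent _) ?_ fun i j => ⟨i, j, .inl rfl⟩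
    · rintro _ ⟨i, j, rfl | ⟨q, rfl⟩⟩ y
      · exact ⟨⟨i, j, .inr ⟨y, mul_assoc _ _ _⟩⟩, i, j, .inr ⟨y, by
          rw [← centerSet_mul_mem (hcent (g i)) (hcent (g j)) y, mul_assoc]⟩⟩
      · exact ⟨⟨i, j, .inr ⟨q * y, by simp only [mul_assoc]⟩⟩, i, j, .inr ⟨y * q, by
          rw [← mul_assoc y, ← hcent (g i) y, mul_assoc, ← mul_assoc y, ← hcent (g j) y,
            mul_assoc]⟩⟩
    · intro k hk
      obtain ⟨i, u, hu, h⟩ : ∃ i, ∃ u ∈ L, a (g k) = a (g i) * u := by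
        obtain ⟨i, j, h | ⟨q, h⟩⟩ := hk
        · exact ⟨i, _, ⟨_, hBN (ha _).1, .inl rfl⟩, h⟩
        · exact ⟨i, _, ⟨_, hBN (ha _).1, .inr ⟨q, rfl⟩⟩, h⟩
      obtain rfl | hik := eq_or_ne k i
      · exact (ha _).2 (hLo hu h)
      · exact hD k i hik ⟨u, hu, h⟩

section Group

theorem AbsolutelyT1SClosed.mem_range_of_submonoids {X : Type u} [Semigroup X]
    (hX : AbsolutelyT1SClosed X) {K : Type u} [Group K] (φ : X →ₙ* WithZero K)
    {P : ℕ → Submonoid K} (hanti : Antitone P) (hcent : ∀ k, ∀ g ∈ P k, ∀ x, g * x = x * g)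
    (hinter : ∀ g, (∀ k, g ∈ P k) → g = 1) {p : K}
    (hp : ∀ k, ∃ g ∈ P k, ((p * g : K) : WithZero K) ∈ range φ) :
    (p : WithZero K) ∈ range φ := by
  have hB : (⨅ k, 𝓟 (P k : Set K)).HasAntitoneBasis fun k => (P k : Set K) :=
    .iInf_principal fun _ _ h => hanti h
  let n (y : WithZero K) : Filter (WithZero K) :=
    map (fun g : K => y * (g : WithZero K)) (⨅ k, 𝓟 (P k : Set K))
  have hn {y : WithZero K} {s : Set (WithZero K)} :
      s ∈ n y ↔ ∃ k, ∀ g ∈ P k, y * (g : WithZero K) ∈ s := by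
    rw [mem_map, hB.mem_iff]
    rfl
  refine hX.mem_range_of_nhds φ n ?_ ?_ ?_ ?_ ?_
  · intro y s hs
    obtain ⟨k, hk⟩ := hn.1 hs
    simpa using hk 1 (one_mem _)
  · intro y s hs
    obtain ⟨k, hk⟩ := hn.1 hs
    refine hn.2 ⟨k, fun g hg => hn.2 ⟨k, fun g' hg' => ?_⟩⟩
    rw [mul_assoc, ← WithZero.coe_mul]
    exact hk _ (mul_mem hg hg')
  · intro y z hyz
    rw [hn]
    induction y with
    | zero => exact ⟨0, fun g _ => by simpa using hyz⟩
    | coe a =>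
      induction z with
      | zero => exact ⟨0, fun g _ => by simp⟩
      | coe b =>
        by_contra! hall
        refine hyz (congrArg _ (inv_mul_eq_one.1 (hinter (a⁻¹ * b) fun k => ?_)))
        obtain ⟨g, hg, hgb⟩ := hall k
        have : a * g = b := by simpa [← WithZero.coe_mul] using hgb
        rwa [← this, inv_mul_cancel_left]
  · intro y z s hs
    obtain ⟨k, hk⟩ := hn.1 hs
    have hself (y : WithZero K) : {w | ∃ g ∈ P k, y * (g : WithZero K) = w} ∈ n y :=
      hn.2 ⟨k, fun g hg => ⟨g, hg, rfl⟩⟩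
    refine mem_map.2 (mem_of_superset (prod_mem_prod (hself y) (hself z)) ?_)
    rintro ⟨_, _⟩ ⟨⟨g, hg, rfl⟩, g', hg', rfl⟩
    have hcomm : (g : WithZero K) * z = z * g := by
      induction z with
      | zero => simp
      | coe b => rw [← WithZero.coe_mul, ← WithZero.coe_mul, hcent k g hg]
    change y * g * (z * g') ∈ s
    rw [mul_assoc, ← mul_assoc (g : WithZero K), hcomm, mul_assoc, ← mul_assoc,
      ← WithZero.coe_mul]
    exact hk _ (mul_mem hg hg')
  · intro hev
    obtain ⟨k, hk⟩ := hn.1 hev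
    obtain ⟨g, hg, hgr⟩ := hp k
    exact hk g hg (by rwa [← WithZero.coe_mul])

theorem AbsolutelyT1SClosed.false_of_closure {X : Type u} [Semigroup X]
    (hX : AbsolutelyT1SClosed X) {G : Type u} [Group G] (φ : X →ₙ* WithZero G)
    (hφ : ∀ g : G, (g : WithZero G) ∈ range φ) {A : Type*} [CommGroup A] (ι : A →* G)
    (hι : Function.Injective ι) (hcent : ∀ a g, ι a * g = g * ι a)
    {C : Type} [CommGroup C] {s : C} (hs : s ≠ 1)
    (t : ℕ → A)
    (hinter : ∀ g : A × C,
      (∀ k, g ∈ Submonoid.closure ((fun n => (t n, s)) '' Ici k)) → g = 1) : False := by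
  let j : A × C →* G × C := ι.prodMap (.id C)
  have hj : Function.Injective j :=
    Function.Injective.prodMap hι Function.injective_id
  let ψ : X →ₙ* WithZero (G × C) := (WithZero.map' (MonoidHom.inl G C) : _ →ₙ* _).comp φ
  let P (k : ℕ) : Submonoid (A × C) :=
    Submonoid.closure ((fun n => (t n, s)) '' Ici k)
  have hmem : (((1, s⁻¹) : G × C) : WithZero (G × C)) ∈ range ψ := by
    refine hX.mem_range_of_submonoids ψ (P := fun k => (P k).map j) (fun k l hkl =>
      Submonoid.monotone_map (Submonoid.closure_mono (image_mono (Ici_subset_Ici.2 hkl))))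
      ?_ ?_ ?_
    · rintro k _ ⟨⟨g, c⟩, -, rfl⟩ ⟨x, d⟩
      exact Prod.ext (hcent g x) (mul_comm c d)
    · intro g hg
      obtain ⟨a, -, rfl⟩ := hg 0
      rw [hinter a fun k => (Submonoid.mem_map_iff_mem hj).1 (hg k), map_one]
    · intro k
      obtain ⟨x, hx⟩ := hφ (ι (t k))
      refine ⟨j (t k, s), ⟨_, Submonoid.subset_closure ⟨k, self_mem_Ici, rfl⟩, rfl⟩, x, ?_⟩
      change WithZero.map' (MonoidHom.inl G C) (φ x) = _
      rw [hx, WithZero.map'_coe]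
      simp [j]
  obtain ⟨x, hx⟩ := hmem
  have hcase (y : WithZero G) :
      WithZero.map' (MonoidHom.inl G C) y ≠ (((1, s⁻¹) : G × C) : WithZero (G × C)) := by
    induction y with
    | zero => simp
    | coe a =>
      rw [WithZero.map'_coe, Ne, WithZero.coe_inj]
      intro h
      exact hs (inv_eq_one.1 (congrArg Prod.snd h).symm)
  exact hcase _ hx

theorem exists_eq_mul_pow_of_mem_closure {A : Type*} [CommGroup A] {t : ℕ → A} {m : ℕ → ℕ}
    (hm : ∀ n n', n < n' → m n * orderOf (t n) ∣ m n') {k : ℕ} {g : A × Multiplicative ℤ}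
    (hg : g ∈ Submonoid.closure ((fun n => (t n, Multiplicative.ofAdd (1 : ℤ))) '' Ici k)) :
    g = 1 ∨ ∃ n i j : ℕ, k ≤ n ∧ 1 ≤ i ∧ i ≤ j ∧ g.2 = Multiplicative.ofAdd (j : ℤ) ∧
      ∃ s, s ^ m n = 1 ∧ g.1 = s * t n ^ i := by
  induction hg using Submonoid.closure_induction with
  | one => exact .inl rfl
  | mem _ h =>
    obtain ⟨n, hn, rfl⟩ := h
    exact .inr ⟨n, 1, 1, hn, le_rfl, le_rfl, rfl, 1, one_pow _, by simp⟩
  | mul x y _ _ hx hy =>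
    obtain rfl | ⟨n, i, j, hn, hi, hij, hx2, s, hs, hx1⟩ := hx
    · simpa using hy
    obtain rfl | ⟨n', i', j', hn', hi', hij', hy2, s', hs', hy1⟩ := hy
    · exact .inr ⟨n, i, j, hn, hi, hij, by simpa using hx2, s, hs, by simpa using hx1⟩
    have h2 : (x * y).2 = Multiplicative.ofAdd ((j + j' : ℕ) : ℤ) := by
      rw [Prod.snd_mul, hx2, hy2, Nat.cast_add, ofAdd_add]
    have key {s : A} {n n' i : ℕ} (h : n < n') (hs : s ^ m n = 1) : (s * t n ^ i) ^ m n' = 1 := by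
      obtain ⟨d, hd⟩ := hm n n' h
      rw [mul_pow, ← pow_mul, mul_comm i, pow_mul, hd, mul_assoc, pow_mul, hs, one_pow, one_mul,
        mul_left_comm, pow_mul, pow_orderOf_eq_one, one_pow, one_pow]
    refine .inr ?_
    obtain h | rfl | h := lt_trichotomy n n'
    · refine ⟨n', i', j + j', hn', hi', by lia, h2, s * t n ^ i * s', ?_, ?_⟩
      · rw [mul_pow, key h hs, hs', one_mul]
      · rw [Prod.fst_mul, hx1, hy1, ← mul_assoc]
    · refine ⟨n, i + i', j + j', hn, by lia, by lia, h2, s * s', ?_, ?_⟩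
      · rw [mul_pow, hs, hs', one_mul]
      · rw [Prod.fst_mul, hx1, hy1, pow_add, mul_mul_mul_comm]
    · refine ⟨n, i, j + j', hn, hi, by lia, h2, s' * t n' ^ i' * s, ?_, ?_⟩
      · rw [mul_pow, key h hs', hs, one_mul]
      · rw [Prod.fst_mul, hx1, hy1, mul_comm, ← mul_assoc]

theorem AbsolutelyT1SClosed.exists_orderOf_le {X : Type u} [Semigroup X]
    (hX : AbsolutelyT1SClosed X) {G : Type u} [Group G] (φ : X →ₙ* WithZero G)
    (hφ : ∀ g : G, (g : WithZero G) ∈ range φ) {A : Type*} [CommGroup A] (ι : A →* G)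
    (hι : Function.Injective ι) (hcent : ∀ a g, ι a * g = g * ι a) :
    ∃ N, ∀ t : A, IsOfFinOrder t → orderOf t ≤ N := by
  by_contra! hN
  choose T hT hTN using hN
  let m : ℕ → ℕ := fun n => n.rec 1 fun n mn => mn * orderOf (T (n * mn))
  let t (n : ℕ) := T (n * m n)
  have hmsucc (n : ℕ) : m (n + 1) = m n * orderOf (t n) := rfl
  have hmpos (n : ℕ) : 0 < m n := by
    induction n with
    | zero => exact one_pos
    | succ n ih => exact Nat.mul_pos ih (hT _).orderOf_pos
  have hm (n n' : ℕ) (h : n < n') : m n * orderOf (t n) ∣ m n' := by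
    induction n', h using Nat.le_induction with
    | base => exact dvd_rfl
    | succ n' _ ih => exact ih.trans (Dvd.intro _ rfl)
  refine hX.false_of_closure φ hφ ι hι hcent (C := Multiplicative ℤ) (s := Multiplicative.ofAdd 1)
    (by decide) t fun g hg => ?_
  by_contra hg1
  have hrep (k : ℕ) := (exists_eq_mul_pow_of_mem_closure hm (hg k)).resolve_left hg1
  obtain ⟨n, i, j, -, -, -, hj, s, hs, hg⟩ := hrep 0
  have hfin : IsOfFinOrder g.1 := by
    rw [hg]
    exact (isOfFinOrder_iff_pow_eq_one.2 ⟨_, hmpos n, hs⟩).mul (hT _).pow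
  obtain ⟨n', i', j', hn', hi', hij', hj', s', hs', hg'⟩ := hrep (j * orderOf g.1)
  have hjj : j' = j := by
    have := hj'.symm.trans hj
    exact_mod_cast Multiplicative.ofAdd.injective this
  have hpow : t n' ^ (i' * (m n' * orderOf g.1)) = 1 := by
    have : g.1 ^ (m n' * orderOf g.1) = 1 := by rw [mul_comm, pow_mul, pow_orderOf_eq_one, one_pow]
    rwa [hg', mul_pow, pow_mul, hs', one_pow, one_mul, ← pow_mul, ← hg'] at this
  have hle := orderOf_le_of_pow_eq_one
    (Nat.mul_pos hi' (Nat.mul_pos (hmpos n') hfin.orderOf_pos)) hpow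
  have hlt : n' * m n' < orderOf (t n') := hTN _
  have : i' * (m n' * orderOf g.1) ≤ n' * m n' := by
    rw [mul_comm (m n'), ← mul_assoc]
    exact Nat.mul_le_mul_right _ ((Nat.mul_le_mul_right _ (hij'.trans hjj.le)).trans hn')
  lia

theorem finite_pow_eq_one_of_prime {A : Type*} [CommGroup A]
    (h : ∀ q : ℕ, q.Prime → {t : A | t ^ q = 1}.Finite) {N : ℕ} (hN : N ≠ 0) :
    {t : A | t ^ N = 1}.Finite := by
  induction N using induction_on_primes with
  | zero => exact (hN rfl).elim
  | one => simp
  | prime_mul q n hq ih =>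
    simp only [pow_mul]
    refine Set.Finite.preimage' (f := fun t : A => t ^ q) (ih (right_ne_zero_of_mul hN))
      fun b _ => ?_
    obtain hemp | ⟨a, rfl⟩ := ((fun t : A => t ^ q) ⁻¹' {b}).eq_empty_or_nonempty
    · simp [hemp]
    · refine ((h q hq).image (a * ·)).subset fun x hx => ⟨a⁻¹ * x, ?_, mul_inv_cancel_left _ _⟩
      rw [mem_ofPred_eq, mul_pow, inv_pow]
      exact inv_mul_eq_one.2 hx.symm

theorem exists_seq_linearIndependent (k : Type*) {V : Type*} [Field k] [Finite k]
    [AddCommGroup V] [Module k V] [Infinite V] : ∃ e : ℕ → V, LinearIndependent k e := by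
  let b := Module.Basis.ofVectorSpace k V
  have : Infinite (Module.Basis.ofVectorSpaceIndex k V) := by
    by_contra hfin
    have := not_infinite_iff_finite.1 hfin
    have : Module.Finite k V := Module.Finite.of_basis b
    exact not_finite_iff_infinite.2 ‹_› (Module.finite_of_finite k)
  let f := Infinite.natEmbedding (Module.Basis.ofVectorSpaceIndex k V)
  exact ⟨b ∘ f, b.linearIndependent.comp f f.injective⟩

theorem AbsolutelyT1SClosed.finite_of_zmod_module {X : Type u} [Semigroup X]
    (hX : AbsolutelyT1SClosed X) {G : Type u} [Group G] (φ : X →ₙ* WithZero G)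
    (hφ : ∀ g : G, (g : WithZero G) ∈ range φ) {q : ℕ} [Fact q.Prime] {V : Type*} [AddCommGroup V]
    [Module (ZMod q) V] (ι : Multiplicative V →* G) (hι : Function.Injective ι)
    (hcent : ∀ a g, ι a * g = g * ι a) : Finite V := by
  by_contra hinf
  have : Infinite V := not_finite_iff_infinite.1 hinf
  obtain ⟨e, hli⟩ := exists_seq_linearIndependent (ZMod q) (V := V)
  let Φ := Finsupp.linearCombination (ZMod q) e
  let σ := Finsupp.linearCombination (ZMod q) fun _ : ℕ => (1 : ZMod q)
  have hrep {k : ℕ} {g : Multiplicative V × Multiplicative (ZMod q)}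
      (hg : g ∈ Submonoid.closure ((fun n => (Multiplicative.ofAdd (e n),
        Multiplicative.ofAdd (1 : ZMod q))) '' Ici k)) :
      ∃ c : ℕ →₀ ZMod q, (∀ n < k, c n = 0) ∧ g.1 = Multiplicative.ofAdd (Φ c) ∧
        g.2 = Multiplicative.ofAdd (σ c) := by
    induction hg using Submonoid.closure_induction with
    | one => exact ⟨0, fun _ _ => rfl, by simp, by simp⟩
    | mem _ h =>
      obtain ⟨n, hn, rfl⟩ := h
      refine ⟨.single n 1, fun l hl => Finsupp.single_eq_of_ne (hl.trans_le hn).ne, ?_, ?_⟩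
      · simp [Φ]
      · simp [σ]
    | mul x y _ _ hx hy =>
      obtain ⟨c, hc, h1, h2⟩ := hx
      obtain ⟨d, hd, h3, h4⟩ := hy
      refine ⟨c + d, fun n hn => by simp [hc n hn, hd n hn], ?_, ?_⟩
      · simp [h1, h3]
      · simp [h2, h4]
  refine hX.false_of_closure φ hφ ι hι hcent (C := Multiplicative (ZMod q))
    (s := Multiplicative.ofAdd 1) (by simp) (fun n => Multiplicative.ofAdd (e n)) fun g hg => ?_
  obtain ⟨c, -, h1, h2⟩ := hrep (hg 0)
  have hc : c = 0 := Finsupp.ext fun n => by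
    obtain ⟨d, hd, h3, -⟩ := hrep (hg (n + 1))
    have : c = d := hli (Multiplicative.ofAdd.injective (h1.symm.trans h3))
    rw [this, hd n n.lt_succ_self, Finsupp.zero_apply]
  refine Prod.ext ?_ ?_ <;> simp [h1, h2, hc]

theorem AbsolutelyT1SClosed.finite_pow_prime_eq_one {X : Type u} [Semigroup X]
    (hX : AbsolutelyT1SClosed X) {G : Type u} [Group G] (φ : X →ₙ* WithZero G)
    (hφ : ∀ g : G, (g : WithZero G) ∈ range φ) {A : Type*} [CommGroup A] (ι : A →* G)
    (hι : Function.Injective ι) (hcent : ∀ a g, ι a * g = g * ι a) {q : ℕ} (hq : q.Prime) :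
    {t : A | t ^ q = 1}.Finite := by
  have : Fact q.Prime := ⟨hq⟩
  let N := (powMonoidHom q : A →* A).ker
  let _ : Module (ZMod q) (Additive N) := AddCommGroup.zmodModule fun v =>
    congrArg Additive.ofMul (Subtype.ext v.toMul.2 : v.toMul ^ q = 1)
  let ι' : Multiplicative (Additive N) →* G :=
    (ι.comp N.subtype).comp (MulEquiv.multiplicativeAdditive N).toMonoidHom
  have hfin : Finite (Additive N) := hX.finite_of_zmod_module φ hφ (q := q) ι'
    (hι.comp (Subtype.val_injective.comp (MulEquiv.multiplicativeAdditive N).injective))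
    fun a g => hcent _ g
  exact (Set.finite_coe_iff (s := {t : A | t ^ q = 1})).1 hfin

theorem AbsolutelyT1SClosed.finite_isOfFinOrder_of_central {X : Type u} [Semigroup X]
    (hX : AbsolutelyT1SClosed X) {G : Type u} [Group G] (φ : X →ₙ* WithZero G)
    (hφ : ∀ g : G, (g : WithZero G) ∈ range φ) {A : Type*} [CommGroup A] (ι : A →* G)
    (hι : Function.Injective ι) (hcent : ∀ a g, ι a * g = g * ι a) :
    {t : A | IsOfFinOrder t}.Finite := by
  obtain ⟨N, hN⟩ := hX.exists_orderOf_le φ hφ ι hι hcent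
  refine (finite_pow_eq_one_of_prime (fun q hq =>
    hX.finite_pow_prime_eq_one φ hφ ι hι hcent hq) N.factorial_ne_zero).subset
      fun t ht => ?_
  exact orderOf_dvd_iff_pow_eq_one.1 (Nat.dvd_factorial (IsOfFinOrder.orderOf_pos ht) (hN t ht))

end Group

section Idempotent

variable {X : Type*} [Semigroup X] {e : X}

theorem self_mem_maxSubgroup (he : e * e = e) : e ∈ maxSubgroup X e := ⟨he, he, e, he, he, he, he⟩

theorem mul_mem_maxSubgroup {x y : X} (hx : x ∈ maxSubgroup X e) (hy : y ∈ maxSubgroup X e) :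
    x * y ∈ maxSubgroup X e := by
  obtain ⟨hx1, hx2, x', hx3, hx4, hx5, hx6⟩ := hx
  obtain ⟨hy1, hy2, y', hy3, hy4, hy5, hy6⟩ := hy
  refine ⟨by rw [mul_assoc, hy1], by rw [← mul_assoc, hx2], y' * x', by rw [mul_assoc, hx3],
    by rw [← mul_assoc, hy4], ?_, ?_⟩
  · rw [mul_assoc, ← mul_assoc y, hy5, hx4, hx5]
  · rw [mul_assoc, ← mul_assoc x', hx6, hy2, hy6]

theorem eq_of_mem_maxSubgroup_of_mul_self {u : X} (hu : u ∈ maxSubgroup X e) (huu : u * u = u) :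
    u = e := by
  obtain ⟨h1, -, y, -, -, h2, -⟩ := hu
  rw [← h1, ← h2, ← mul_assoc, huu]

theorem mul_mul_mul_of_mem_HeCoideal {x y : X} (hy : y ∈ HeCoideal X e) :
    x * e * (y * e) = x * y * e := by
  rw [mul_assoc, hy.2.2.1, mul_assoc]

theorem isPrimeSet_HeCoideal (hec : e ∈ centerSet X) (hev : e ∈ viableIdems X) :
    IsPrimeSet (HeCoideal X e) := by
  refine fun x y => ⟨fun hxy => ⟨?_, ?_⟩, fun ⟨hx, hy⟩ => ⟨(hec _).symm, ?_⟩⟩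
  · by_contra hx
    exact ((hev.2 x ⟨trivial, hx⟩ y).1).2 hxy
  · by_contra hy
    exact ((hev.2 y ⟨trivial, hy⟩ x).2).2 hxy
  · rw [← mul_mul_mul_of_mem_HeCoideal hy]
    exact mul_mem_maxSubgroup hx.2 hy.2

theorem mem_HeCoideal_iff (hec : e ∈ centerSet X) (he : e * e = e) {f : X} (hf : f * f = f) :
    f ∈ HeCoideal X e ↔ e * f = e := by
  constructor
  · intro h
    rw [hec]
    refine eq_of_mem_maxSubgroup_of_mul_self h.2 ?_
    rw [mul_mul_mul_of_mem_HeCoideal h, hf]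
  · intro h
    refine ⟨(hec f).symm, ?_⟩
    rw [← hec, h]
    exact self_mem_maxSubgroup he

theorem HeCoideal_subset {f : X} (hP : IsPrimeSet (HeCoideal X f)) (he : e ∈ HeCoideal X f) :
    HeCoideal X e ⊆ HeCoideal X f := by
  rintro x ⟨-, -, -, y, -, -, h, -⟩
  exact ((hP _ _).1 ((hP _ _).1 (h ▸ he)).1).1

/-- The maximal subgroup containing the idempotent `e` as a group. -/
noncomputable abbrev maxSubgroupGroup (he : e * e = e) : Group (maxSubgroup X e) :=
  let _ : Mul (maxSubgroup X e) := ⟨fun x y => ⟨x * y, mul_mem_maxSubgroup x.2 y.2⟩⟩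
  let _ : One (maxSubgroup X e) := ⟨⟨e, self_mem_maxSubgroup he⟩⟩
  have hinv (x : maxSubgroup X e) : ∃ y : maxSubgroup X e, y * x = 1 := by
    obtain ⟨x, hx1, hx2, y, hy1, hy2, hxy, hyx⟩ := x
    exact ⟨⟨y, hy1, hy2, x, hx1, hx2, hyx, hxy⟩, Subtype.ext hyx⟩
  let _ : Inv (maxSubgroup X e) := ⟨fun x => (hinv x).choose⟩
  Group.ofLeftAxioms (fun _ _ _ => Subtype.ext (mul_assoc _ _ _)) (fun x => Subtype.ext x.2.2.1)
    fun x => (hinv x).choose_spec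

theorem spow_eq_pow {M : Type*} [Monoid M] (x : M) (n : ℕ) : spow x n = x ^ (n + 1) := by
  induction n with
  | zero => exact (pow_one x).symm
  | succ n ih => rw [pow_succ, ← ih, spow]

theorem mem_maxSubgroup_of_spow_eq {z : X} {n : ℕ} (hz : z ∈ centerSet X) (hn : spow z n = e)
    (he : e * e = e) (hez : e * z = z) : z ∈ maxSubgroup X e := by
  have hpow (m : ℕ) : e * spow z m = spow z m := by
    induction m with
    | zero => exact hez
    | succ m ih => rw [spow, ← mul_assoc, ih]
  have hinv : spow z (2 * n) * z = e := by
    rw [← he]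
    nth_rw 1 [← hn]
    rw [← hn, spow_mul_spow, ← two_mul]
    rfl
  exact ⟨by rw [hz, hez], hez, spow z (2 * n), by rw [spow_mem_centerSet hz, hpow], hpow _,
    by rw [hz, hinv], hinv⟩

end Idempotent

theorem AbsolutelyT1SClosed.finite_centralRoots_inter_maxSubgroup {X : Type u} [Semigroup X]
    (hX : AbsolutelyT1SClosed X) {e : X} (hec : e ∈ centerSet X) (hev : e ∈ viableIdems X) :
    (centralRoots X e ∩ maxSubgroup X e).Finite := by
  let _ : Group (maxSubgroup X e) := maxSubgroupGroup hev.1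
  have hP := isPrimeSet_HeCoideal hec hev
  let φ : X →ₙ* WithZero (maxSubgroup X e) :=
    { toFun := fun x => open Classical in
        if hx : x ∈ HeCoideal X e then ((⟨x * e, hx.2⟩ : maxSubgroup X e) : WithZero _) else 0
      map_mul' := fun x y => by
        by_cases hxy : x * y ∈ HeCoideal X e
        · obtain ⟨hx, hy⟩ := (hP x y).1 hxy
          rw [dif_pos hxy, dif_pos hx, dif_pos hy, ← WithZero.coe_mul]
          exact congrArg _ (Subtype.ext (mul_mul_mul_of_mem_HeCoideal hy).symm)
        · rw [dif_neg hxy]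
          rw [hP, not_and_or] at hxy
          obtain h | h := hxy <;> simp [h] }
  have hφ (g : maxSubgroup X e) : (g : WithZero (maxSubgroup X e)) ∈ range φ := by
    have hge : (g : X) * e = g := g.2.1
    have hg : (g : X) ∈ HeCoideal X e := ⟨(hec _).symm, by rw [hge]; exact g.2⟩
    exact ⟨g, (dif_pos hg).trans (congrArg _ (Subtype.ext hge))⟩
  let A := Subgroup.center (maxSubgroup X e)
  let _ : CommGroup A := IsMulCommutative.instCommGroup
  have hfin := hX.finite_isOfFinOrder_of_central φ hφ A.subtype Subtype.val_injective
    fun a g => (Subgroup.mem_center_iff.1 a.2 g).symm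
  refine (hfin.image fun a : A => (a.1 : X)).subset ?_
  rintro z ⟨⟨hz, n, hn⟩, hze⟩
  have hzA : (⟨z, hze⟩ : maxSubgroup X e) ∈ A :=
    Subgroup.mem_center_iff.2 fun g => Subtype.ext (hz g).symm
  refine ⟨⟨⟨z, hze⟩, hzA⟩, ?_, rfl⟩
  refine isOfFinOrder_iff_pow_eq_one.2 ⟨n + 1, n.succ_pos, Subtype.ext (Subtype.ext ?_)⟩
  let val : maxSubgroup X e →ₙ* X := ⟨Subtype.val, fun _ _ => rfl⟩
  change val ((⟨z, hze⟩ : maxSubgroup X e) ^ (n + 1)) = e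
  rw [← spow_eq_pow, map_spow]
  exact hn

theorem AbsolutelyT1SClosed.finite_centralRoots {X : Type u} [Semigroup X]
    (hX : AbsolutelyT1SClosed X) {e : X} (hec : e ∈ centerSet X) (hev : e ∈ viableIdems X) :
    (centralRoots X e).Finite := by
  have hI : IsIdealSet X {x | e * x = x} := fun x hx y =>
    ⟨(mul_assoc e x y).symm.trans (congrArg (· * y) hx), by
      change e * (y * x) = y * x
      rw [← mul_assoc, hec y, mul_assoc, hx]⟩
  have heI : e * e = e := hev.1
  have hQ := (hX.of_surjective (reesMk hI) (reesMk_surjective hI)).finite_centralRoots_zero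
    (o := reesMk hI e) fun q => by
      obtain ⟨x, rfl⟩ := reesMk_surjective hI q
      rw [← map_mul, ← map_mul, reesMk_eq_iff, reesMk_eq_iff]
      exact ⟨.inr ⟨(hI e heI x).1, heI⟩, .inr ⟨(hI e heI x).2, heI⟩⟩
  have hdiff : (centralRoots X e \ {x | e * x = x}).Finite := by
    refine Finite.of_injOn (f := reesMk hI) ?_ ?_ hQ
    · rintro z ⟨⟨hz, n, hn⟩, -⟩
      refine ⟨fun q => ?_, n, by rw [← map_spow, hn]⟩
      obtain ⟨x, rfl⟩ := reesMk_surjective hI q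
      rw [← map_mul, ← map_mul, hz]
    · rintro x ⟨-, hx⟩ y - hxy
      exact ((reesMk_eq_iff hI).1 hxy).resolve_right fun h => hx h.1
  refine (hdiff.union (hX.finite_centralRoots_inter_maxSubgroup hec hev)).subset fun z hz => ?_
  by_cases hez : e * z = z
  · obtain ⟨n, hn⟩ := hz.2
    exact .inr ⟨hz, mem_maxSubgroup_of_spow_eq hz.1 hn heI hez⟩
  · exact .inl ⟨hz, hez⟩

theorem AbsolutelyT1SClosed.finite_centerSet_inter_viableIdems {X : Type u} [Semigroup X]
    (hX : AbsolutelyT1SClosed X) : (centerSet X ∩ viableIdems X).Finite := by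
  by_contra hinf
  let f := Set.Infinite.natEmbedding _ hinf
  let r (x y : X) : Prop := x * y = x
  have : IsTrans X r := ⟨fun x y z hxy hyz => by
    change x * z = x
    rw [← hxy, mul_assoc, hyz]⟩
  obtain ⟨g, hg, hr⟩ := exists_increasing_or_decreasing_or_antichain_subseq r fun n => (f n : X)
  let e (n : ℕ) : X := f (g n)
  have hec (n : ℕ) : e n ∈ centerSet X := (f (g n)).2.1
  have hev (n : ℕ) : e n ∈ viableIdems X := (f (g n)).2.2
  have hne {m n : ℕ} (hmn : m ≠ n) : e m ≠ e n := fun h =>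
    hmn (hg.injective (f.injective (Subtype.ext h)))
  have hP (n : ℕ) := isPrimeSet_HeCoideal (hec n) (hev n)
  have hmem (m n : ℕ) : e m ∈ HeCoideal X (e n) ↔ e n * e m = e n :=
    mem_HeCoideal_iff (hec n) (hev n).1 (hev m).1
  have hself (n : ℕ) : e n * e n = e n := (hev n).1
  obtain hr | hr | hr := hr
  · refine hX.not_strictAnti_prime hP e fun m n => ?_
    rw [hmem]
    obtain h | rfl | h := lt_trichotomy m n
    · refine iff_of_false ?_ h.not_ge
      rw [hec, hr m n h]
      exact hne h.ne
    · simp [hself]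
    · exact iff_of_true (hr n m h) h.le
  · have hle {m n : ℕ} (h : m ≤ n) : e n * e m = e n := by
      obtain rfl | h := h.eq_or_lt
      exacts [hself m, hr m n h]
    refine hX.not_strictMono_prime hP (fun m n h => HeCoideal_subset (hP n) ((hmem m n).2 (hle h)))
      e fun m n => (hmem m n).trans ⟨fun h => ?_, hle⟩
    by_contra! hlt
    rw [hec, hr n m hlt] at h
    exact hne hlt.ne' h
  · refine hX.not_antichain_prime hP e fun m n => (hmem m n).trans ⟨fun h => ?_, ?_⟩
    · by_contra hmn
      exact hr n m (Ne.symm hmn) h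
    · rintro rfl
      exact hself m

theorem statement5 (X : Type u) [Semigroup X] (hX : AbsolutelyT1SClosed X) :
    (centerSet X ∩ sqrtSet X (viableIdems X)).Finite := by
  refine (hX.finite_centerSet_inter_viableIdems.biUnion fun e he =>
    hX.finite_centralRoots he.1 he.2).subset ?_
  rintro z ⟨hz, n, hn⟩
  exact mem_biUnion ⟨spow_mem_centerSet hz n, hn⟩ ⟨hz, n, rfl⟩
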